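/- arXiv:1103.2837 — 9 statements merged into one kernel-verified Lean document; each statement's English description precedes it below -/
import Mathlib

section
/- Robustness of LP decoding (Lemma 1, all-zero codeword form): Let S ⊆ {1,…,n} and C > 1, and suppose FCP(S,C) holds for H. Let x^r ∈ {0,1}^n be any received word and let x^p ∈ K(H) satisfy ‖x^p − x^r‖₁ ≤ ‖x^r‖₁ (i.e., x^p does at least as well as the all-zero codeword in the ℓ1-distance LP objective). If x^p ≠ 0, then ‖x^p‖₁ < 2·((C+1)/(C−1))·‖(x^r)_{S^c}‖₁. -/
open Finset

/-- The fundamental cone `K(H)` of a binary parity-check matrix `H`. -/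
def fundCone {m n : ℕ} (H : Fin m → Fin n → Bool) : Set (Fin n → ℝ) :=
  {ω | (∀ i, 0 ≤ ω i) ∧
    ∀ j : Fin m, ∀ i, H j i = true →
      ω i ≤ ∑ i' ∈ (Finset.univ.filter fun i' => H j i' = true).erase i, ω i'}

/-- The fundamental cone property `FCP(S, C)`. -/
def FCP {m n : ℕ} (H : Fin m → Fin n → Bool) (S : Finset (Fin n)) (C : ℝ) : Prop :=
  ∀ ω ∈ fundCone H, ω ≠ 0 → C * ∑ i ∈ S, |ω i| < ∑ i ∈ Sᶜ, |ω i|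

/-- Robustness of LP decoding (all-zero codeword form). -/
theorem robustness_of_LP_decoding {m n : ℕ} (H : Fin m → Fin n → Bool)
    (S : Finset (Fin n)) (C : ℝ) (hC : 1 < C) (hFCP : FCP H S C)
    (xr : Fin n → ℝ) (hxr : ∀ i, xr i = 0 ∨ xr i = 1)
    (xp : Fin n → ℝ) (hxp : xp ∈ fundCone H)
    (hobj : ∑ i, |xp i - xr i| ≤ ∑ i, |xr i|)
    (hne : xp ≠ 0) :
    ∑ i, |xp i| < 2 * ((C + 1) / (C - 1)) * ∑ i ∈ Sᶜ, |xr i| := by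
  have hS : ∑ i ∈ S, (|xr i| - |xp i|) ≤ ∑ i ∈ S, |xp i - xr i| :=
    sum_le_sum fun i _ => by
      rw [abs_sub_comm (xp i)]
      exact abs_sub_abs_le_abs_sub (xr i) (xp i)
  have hSc : ∑ i ∈ Sᶜ, (|xp i| - |xr i|) ≤ ∑ i ∈ Sᶜ, |xp i - xr i| :=
    sum_le_sum fun i _ => abs_sub_abs_le_abs_sub (xp i) (xr i)
  have hcone := hFCP xp hxp hne
  rw [sum_sub_distrib] at hS hSc
  rw [← sum_add_sum_compl S, ← sum_add_sum_compl S fun i => |xr i|] at hobj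
  rw [← sum_add_sum_compl S, mul_div_assoc', div_mul_eq_mul_div, lt_div_iff₀ (by linarith)]
  have hgap : ∑ i ∈ Sᶜ, |xp i| - ∑ i ∈ S, |xp i| ≤ 2 * ∑ i ∈ Sᶜ, |xr i| := by linarith
  have hscaled := mul_le_mul_of_nonneg_left hgap (by linarith : 0 ≤ C + 1)
  linarith
end

section
/- Per-check-node inequality for feasible dual labels: Fix a check node j of H and reals τ_i for i ∈ I_j such that τ_i + τ_{i'} ≥ 0 for all distinct i, i' ∈ I_j. Then every ω ∈ K(H) satisfies Σ_{i∈I_j} ω_i·τ_i ≥ 0. -/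
open Finset

/-- Per-check-node inequality for feasible dual labels. -/
theorem per_check_node_inequality {m n : ℕ} (H : Fin m → Fin n → Bool)
    (j : Fin m) (τ : Fin n → ℝ)
    (hτ : ∀ i, H j i = true → ∀ i', H j i' = true → i ≠ i' → 0 ≤ τ i + τ i')
    (ω : Fin n → ℝ) (hω : ω ∈ fundCone H) :
    0 ≤ ∑ i ∈ Finset.univ.filter (fun i => H j i = true), ω i * τ i := by
  obtain ⟨hω_nonneg, hω_le⟩ := hω
  by_cases h : ∀ i, H j i = true → 0 ≤ τ i
  · exact Finset.sum_nonneg fun i hi =>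
      mul_nonneg (hω_nonneg i) (h i (Finset.mem_filter.mp hi).2)
  push Not at h
  obtain ⟨k, hk, hτk⟩ := h
  rw [← Finset.add_sum_erase _ _ (Finset.mem_filter.mpr ⟨Finset.mem_univ k, hk⟩)]
  have hsum : (∑ i ∈ (Finset.univ.filter fun i => H j i = true).erase k, ω i) * -τ k ≤
      ∑ i ∈ (Finset.univ.filter fun i => H j i = true).erase k, ω i * τ i := by
    rw [Finset.sum_mul]
    refine Finset.sum_le_sum fun i hi => mul_le_mul_of_nonneg_left ?_ (hω_nonneg i)
    obtain ⟨hik, hi⟩ := Finset.mem_erase.mp hi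
    linarith [hτ i (Finset.mem_filter.mp hi).2 k hk hik]
  linarith [mul_le_mul_of_nonneg_right (hω_le j k hk) (neg_nonneg.mpr hτk.le)]
end

section
/- Feasible dual variables certify strictly positive cost on the fundamental cone: Let γ ∈ ℝ^n and suppose there exists a feasible dual set (τ_{ij}) for γ. Then every nonzero ω ∈ K(H) satisfies Σ_{i=1}^n γ_i·ω_i > 0. -/
open Finset

/-- A feasible dual set of variables `τ` for the log-likelihood vector `γ`. -/
def feasibleDual {m n : ℕ} (H : Fin m → Fin n → Bool) (γ : Fin n → ℝ)
    (τ : Fin n → Fin m → ℝ) : Prop :=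
  (∀ j : Fin m, ∀ i, H j i = true → ∀ i', H j i' = true → i ≠ i' →
      0 ≤ τ i j + τ i' j) ∧
  (∀ i, ∑ j ∈ Finset.univ.filter (fun j => H j i = true), τ i j < γ i)

/-- If the coefficients `t i` have nonnegative pairwise sums and each nonnegative `w i` is at most the
sum of the others, then `∑ t i * w i` is nonnegative. -/
lemma sum_mul_nonneg_of_pairwise_add_nonneg {ι : Type*} [DecidableEq ι] (s : Finset ι)
    (t w : ι → ℝ) (ht : ∀ i ∈ s, ∀ k ∈ s, i ≠ k → 0 ≤ t i + t k) (hw : ∀ i ∈ s, 0 ≤ w i)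
    (hsum : ∀ i ∈ s, w i ≤ ∑ k ∈ s.erase i, w k) : 0 ≤ ∑ i ∈ s, t i * w i := by
  by_cases h : ∀ i ∈ s, 0 ≤ t i
  · exact Finset.sum_nonneg fun i hi => mul_nonneg (h i hi) (hw i hi)
  push Not at h
  obtain ⟨k, hk, hneg⟩ := h
  have hrest : -t k * ∑ i ∈ s.erase k, w i ≤ ∑ i ∈ s.erase k, t i * w i := by
    rw [Finset.mul_sum]
    refine Finset.sum_le_sum fun i hi => ?_
    obtain ⟨hik, his⟩ := Finset.mem_erase.mp hi
    exact mul_le_mul_of_nonneg_right (by linarith [ht i his k hk hik]) (hw i his)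
  have hmul := mul_le_mul_of_nonneg_left (hsum k hk) (neg_nonneg.mpr hneg.le)
  rw [← Finset.add_sum_erase s _ hk]
  linarith

/-- Feasible dual variables certify strictly positive cost on the fundamental cone. -/
theorem feasible_dual_positive_cost {m n : ℕ} (H : Fin m → Fin n → Bool)
    (γ : Fin n → ℝ) (hdual : ∃ τ : Fin n → Fin m → ℝ, feasibleDual H γ τ)
    (ω : Fin n → ℝ) (hω : ω ∈ fundCone H) (hne : ω ≠ 0) :
    0 < ∑ i, γ i * ω i := by
  obtain ⟨τ, hτ, hγ⟩ := hdual
  obtain ⟨hnonneg, hcheck⟩ := hω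
  obtain ⟨k, hk⟩ := Function.ne_iff.mp hne
  have hkpos : 0 < ω k := lt_of_le_of_ne (hnonneg k) (Ne.symm hk)
  calc
    0 ≤ ∑ j, ∑ i ∈ Finset.univ.filter (fun i => H j i = true), τ i j * ω i :=
      Finset.sum_nonneg fun j _ =>
        sum_mul_nonneg_of_pairwise_add_nonneg _ (fun i => τ i j) ω
          (by simpa using hτ j) (fun i _ => hnonneg i) (by simpa using hcheck j)
    _ = ∑ i, (∑ j ∈ Finset.univ.filter (fun j => H j i = true), τ i j) * ω i := by
      simp only [Finset.sum_mul, Finset.sum_filter, ite_mul, zero_mul]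
      exact Finset.sum_comm
    _ < ∑ i, γ i * ω i :=
      Finset.sum_lt_sum (fun i _ => mul_le_mul_of_nonneg_right (hγ i).le (hnonneg i))
        ⟨k, Finset.mem_univ k, mul_lt_mul_of_pos_right (hγ k) hkpos⟩
end

section
/- A dual witness implies success of LP decoding on the BSC: Let E ⊆ {1,…,n} be the set of flipped bits when the all-zero codeword is transmitted, so the received word is 1_E, and let γ ∈ ℝ^n be given by γ_i = −1 for i ∈ E and γ_i = 1 for i ∉ E. If there exists a feasible dual set for γ, then every nonzero x ∈ P(H) satisfies ‖x − 1_E‖₁ > ‖1_E‖₁; that is, the all-zero codeword is the unique minimizer of the ℓ1 distance to the received word over the fundamental polytope. -/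
open Finset

/-- The local codeword set `C_j` of check `j`: binary vectors (as points of `ℝ^n`)
whose coordinates sum to an even number over the support of row `j`. -/
def localCodewords {m n : ℕ} (H : Fin m → Fin n → Bool) (j : Fin m) :
    Set (Fin n → ℝ) :=
  {x | ∃ b : Fin n → Bool, x = (fun i => if b i then (1 : ℝ) else 0) ∧
    Even ((Finset.univ.filter fun i => H j i = true ∧ b i = true).card)}

/-- The fundamental polytope `P(H)`. -/
def fundPolytope {m n : ℕ} (H : Fin m → Fin n → Bool) : Set (Fin n → ℝ) :=
  ⋂ j : Fin m, convexHull ℝ (localCodewords H j)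

/-- A sum over a set with an even number of elements is nonnegative if all sums of two distinct
terms are. -/
theorem sum_nonneg_of_pairwise_add_nonneg {ι : Type*} (s : Finset ι) (t : ι → ℝ)
    (hs : Even s.card) (ht : ∀ i ∈ s, ∀ i' ∈ s, i ≠ i' → 0 ≤ t i + t i') :
    0 ≤ ∑ i ∈ s, t i := by
  classical
  by_cases hpos : ∀ i ∈ s, 0 ≤ t i
  · exact Finset.sum_nonneg hpos
  push Not at hpos
  obtain ⟨a, ha, hneg⟩ := hpos
  have hcard : 1 < s.card := by
    have := Finset.card_pos.mpr ⟨a, ha⟩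
    obtain ⟨k, hk⟩ := hs
    omega
  obtain ⟨b, hb, hba⟩ := Finset.exists_mem_ne hcard a
  have hb' : b ∈ s.erase a := Finset.mem_erase.mpr ⟨hba, hb⟩
  have hle : t b ≤ ∑ i ∈ s.erase a, t i := by
    refine Finset.single_le_sum (f := t) (fun i hi => ?_) hb'
    obtain ⟨hia, his⟩ := Finset.mem_erase.mp hi
    linarith [ht i his a ha hia]
  rw [← Finset.add_sum_erase s t ha]
  linarith [ht a ha b hb hba.symm]

/-- A linear functional that is nonnegative on a set is nonnegative on its convex hull. -/
theorem sum_mul_nonneg_of_mem_convexHull {ι : Type*} [Fintype ι] {S : Set (ι → ℝ)} (c : ι → ℝ)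
    (hS : ∀ y ∈ S, 0 ≤ ∑ i, c i * y i) {x : ι → ℝ} (hx : x ∈ convexHull ℝ S) :
    0 ≤ ∑ i, c i * x i := by
  have hlin : IsLinearMap ℝ (fun y : ι → ℝ => ∑ i, c i * y i) :=
    { map_add := fun y z => by simp [mul_add, Finset.sum_add_distrib]
      map_smul := fun r y => by
        simp only [Pi.smul_apply, smul_eq_mul, Finset.mul_sum]
        exact Finset.sum_congr rfl fun i _ => by ring }
  exact convexHull_min (t := {y : ι → ℝ | 0 ≤ ∑ i, c i * y i}) hS
    (convex_halfSpace_ge hlin 0) hx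

/-- Points in the convex hull of a local code have nonnegative coordinates. -/
theorem nonneg_of_mem_convexHull_localCodewords {m n : ℕ} {H : Fin m → Fin n → Bool} {j : Fin m}
    {x : Fin n → ℝ} (hx : x ∈ convexHull ℝ (localCodewords H j)) (i : Fin n) : 0 ≤ x i := by
  have h := sum_mul_nonneg_of_mem_convexHull (Pi.single i 1) (fun y hy => ?_) hx
  · simpa [Pi.single_apply] using h
  · obtain ⟨b, rfl, -⟩ := hy
    simp only [Pi.single_apply, ite_mul, one_mul, zero_mul, Finset.sum_ite_eq', Finset.mem_univ,
      if_true]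
    split_ifs <;> norm_num

/-- The dual variables at a check node have nonnegative pairing with the hull of its local code. -/
theorem feasibleDual.check_sum_nonneg {m n : ℕ} {H : Fin m → Fin n → Bool} {γ : Fin n → ℝ}
    {τ : Fin n → Fin m → ℝ} (hτ : feasibleDual H γ τ) (j : Fin m) {x : Fin n → ℝ}
    (hx : x ∈ convexHull ℝ (localCodewords H j)) :
    0 ≤ ∑ i, (if H j i = true then τ i j else 0) * x i := by
  refine sum_mul_nonneg_of_mem_convexHull _ (fun y hy => ?_) hx
  obtain ⟨b, rfl, hb⟩ := hy
  have h := sum_nonneg_of_pairwise_add_nonneg _ (fun i => τ i j) hb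
    fun i hi i' hi' hne => hτ.1 j i (Finset.mem_filter.mp hi).2.1 i'
      (Finset.mem_filter.mp hi').2.1 hne
  rw [Finset.sum_filter] at h
  refine h.trans_eq (Finset.sum_congr rfl fun i _ => ?_)
  by_cases h1 : H j i = true <;> by_cases h2 : b i = true <;> simp [h1, h2]

/-- A dual witness makes every nonzero point of the fundamental polytope have positive cost,
provided there is at least one check. -/
theorem feasibleDual.cost_pos {m n : ℕ} [Nonempty (Fin m)] {H : Fin m → Fin n → Bool}
    {γ : Fin n → ℝ} {τ : Fin n → Fin m → ℝ} (hτ : feasibleDual H γ τ) {x : Fin n → ℝ}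
    (hx : x ∈ fundPolytope H) (hne : x ≠ 0) : 0 < ∑ i, γ i * x i := by
  have hx' : ∀ j, x ∈ convexHull ℝ (localCodewords H j) := Set.mem_iInter.mp hx
  have hnonneg := nonneg_of_mem_convexHull_localCodewords (hx' (Classical.arbitrary _))
  obtain ⟨k, hk⟩ := Function.ne_iff.mp hne
  have hk' : 0 < x k := lt_of_le_of_ne (hnonneg k) (Ne.symm hk)
  calc 0 ≤ ∑ j, ∑ i, (if H j i = true then τ i j else 0) * x i :=
        Finset.sum_nonneg fun j _ => hτ.check_sum_nonneg j (hx' j)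
    _ = ∑ i, (∑ j ∈ Finset.univ.filter (fun j => H j i = true), τ i j) * x i := by
        rw [Finset.sum_comm]
        exact Finset.sum_congr rfl fun i _ => by rw [Finset.sum_filter, Finset.sum_mul]
    _ < ∑ i, γ i * x i :=
        Finset.sum_lt_sum (fun i _ => mul_le_mul_of_nonneg_right (hτ.2 i).le (hnonneg i))
          ⟨k, Finset.mem_univ k, mul_lt_mul_of_pos_right (hτ.2 k) hk'⟩

/-- A dual witness implies success of LP decoding on the BSC. -/
theorem dual_witness_implies_LP_success {m n : ℕ} (H : Fin m → Fin n → Bool)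
    (E : Finset (Fin n)) (γ : Fin n → ℝ)
    (hγ : ∀ i, γ i = if i ∈ E then (-1 : ℝ) else 1)
    (hdual : ∃ τ : Fin n → Fin m → ℝ, feasibleDual H γ τ)
    (x : Fin n → ℝ) (hx : x ∈ fundPolytope H) (hne : x ≠ 0) :
    ∑ i, |(if i ∈ E then (1 : ℝ) else 0)| <
      ∑ i, |x i - (if i ∈ E then (1 : ℝ) else 0)| := by
  obtain ⟨τ, hτ⟩ := hdual
  rcases isEmpty_or_nonempty (Fin m) with hm | hm
  · have hE : ∀ i, i ∉ E := fun i hi => by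
      have h := hτ.2 i
      simp only [Finset.univ_eq_empty, Finset.filter_empty, Finset.sum_empty, hγ i, if_pos hi] at h
      linarith
    obtain ⟨k, hk⟩ := Function.ne_iff.mp hne
    simp only [hE, if_false, abs_zero, Finset.sum_const_zero, sub_zero]
    exact Finset.sum_pos' (fun i _ => abs_nonneg _) ⟨k, Finset.mem_univ k, abs_pos.mpr hk⟩
  · have hcost : ∑ i, γ i * x i ≤ ∑ i, (|x i - (if i ∈ E then (1 : ℝ) else 0)| -
        |(if i ∈ E then (1 : ℝ) else 0)|) := by
      refine Finset.sum_le_sum fun i _ => ?_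
      rw [hγ i]
      split_ifs
      · rw [abs_one]
        linarith [neg_abs_le (x i - 1)]
      · simpa using le_abs_self (x i)
    rw [Finset.sum_sub_distrib] at hcost
    linarith [hτ.cost_pos hx hne]
end

section
/- The fundamental cone property with constant 1 implies LP decoding success: Let E ⊆ {1,…,n} and suppose FCP(E,1) holds for H, i.e., every nonzero ω ∈ K(H) satisfies ‖ω_E‖₁ < ‖ω_{E^c}‖₁. Then every nonzero x ∈ P(H) satisfies ‖x − 1_E‖₁ > ‖1_E‖₁; that is, when the all-zero codeword is transmitted and exactly the bits in E are flipped, the all-zero codeword is the unique minimizer of the ℓ1 distance to the received word 1_E over the fundamental polytope. -/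
open Finset

/-- The valid inequalities of the fundamental cone coming from a single check `j` hold on the
convex hull of the local code of `j`. -/
lemma cone_inequalities_of_mem_convexHull_localCodewords {m n : ℕ} (H : Fin m → Fin n → Bool)
    (j : Fin m) {x : Fin n → ℝ} (hx : x ∈ convexHull ℝ (localCodewords H j)) :
    (∀ i, 0 ≤ x i) ∧ ∀ i, H j i = true →
      x i ≤ ∑ i' ∈ (Finset.univ.filter fun i' => H j i' = true).erase i, x i' := by
  refine convexHull_min (t := {x | (∀ i, 0 ≤ x i) ∧ ∀ i, H j i = true →
      x i ≤ ∑ i' ∈ (Finset.univ.filter fun i' => H j i' = true).erase i, x i'}) ?_ ?_ hx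
  · rintro _ ⟨b, rfl, hb⟩
    have hnonneg : ∀ i, (0 : ℝ) ≤ if b i then (1 : ℝ) else 0 := fun i => by split_ifs <;> simp
    refine ⟨hnonneg, fun i hi => ?_⟩
    by_cases hbi : b i = true
    · obtain ⟨k, hk, hki⟩ : ∃ k ∈ Finset.univ.filter (fun i => H j i = true ∧ b i = true),
          k ≠ i := by
        refine Finset.exists_mem_ne ?_ i
        have hpos : 0 < (Finset.univ.filter fun i => H j i = true ∧ b i = true).card :=
          Finset.card_pos.2 ⟨i, Finset.mem_filter.2 ⟨Finset.mem_univ i, hi, hbi⟩⟩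
        obtain ⟨r, hr⟩ := hb
        omega
      obtain ⟨-, hk, hbk⟩ := Finset.mem_filter.1 hk
      have hle := Finset.single_le_sum
        (s := (Finset.univ.filter fun i' => H j i' = true).erase i) (fun i _ => hnonneg i)
        (Finset.mem_erase.2 ⟨hki, Finset.mem_filter.2 ⟨Finset.mem_univ k, hk⟩⟩)
      simpa only [hbi, hbk] using hle
    · beta_reduce
      rw [if_neg hbi]
      exact Finset.sum_nonneg fun k _ => hnonneg k
  · rintro y ⟨hy, hy'⟩ z ⟨hz, hz'⟩ a b ha hb -
    refine ⟨fun i => add_nonneg (mul_nonneg ha (hy i)) (mul_nonneg hb (hz i)), fun i hi => ?_⟩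
    simp only [Pi.add_apply, Pi.smul_apply, smul_eq_mul, Finset.sum_add_distrib,
      ← Finset.mul_sum]
    gcongr
    exacts [hy' i hi, hz' i hi]

/-- Absolute values are only needed when there are no checks, where the fundamental polytope is
the whole space. -/
lemma abs_mem_fundCone {m n : ℕ} {H : Fin m → Fin n → Bool} {x : Fin n → ℝ}
    (hx : x ∈ fundPolytope H) : |x| ∈ fundCone H := by
  refine ⟨fun i => abs_nonneg (x i), fun j => ?_⟩
  obtain ⟨hnonneg, hle⟩ :=
    cone_inequalities_of_mem_convexHull_localCodewords H j (Set.mem_iInter.1 hx j)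
  rwa [abs_of_nonneg (Pi.le_def.2 hnonneg)]

/-- The fundamental cone property with constant 1 implies LP decoding success. -/
theorem FCP_one_implies_LP_success {m n : ℕ} (H : Fin m → Fin n → Bool)
    (E : Finset (Fin n)) (hFCP : FCP H E 1)
    (x : Fin n → ℝ) (hx : x ∈ fundPolytope H) (hne : x ≠ 0) :
    ∑ i, |(if i ∈ E then (1 : ℝ) else 0)| <
      ∑ i, |x i - (if i ∈ E then (1 : ℝ) else 0)| := by
  have hcone := hFCP |x| (abs_mem_fundCone hx) (by simpa using hne)
  simp only [Pi.abs_apply, abs_abs, one_mul] at hcone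
  rw [← Finset.sum_add_sum_compl E, ← Finset.sum_add_sum_compl E]
  have hE : ∑ i ∈ E, |(if i ∈ E then (1 : ℝ) else 0)| ≤
      ∑ i ∈ E, |x i - (if i ∈ E then (1 : ℝ) else 0)| + ∑ i ∈ E, |x i| := by
    rw [← Finset.sum_add_distrib]
    gcongr with i
    rw [← sub_le_iff_le_add, abs_sub_comm (x i)]
    exact abs_sub_abs_le_abs_sub _ _
  have hEc : ∑ i ∈ Eᶜ, |(if i ∈ E then (1 : ℝ) else 0)| = 0 :=
    Finset.sum_eq_zero fun i hi => by simp [Finset.mem_compl.1 hi]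
  have hEc' : ∑ i ∈ Eᶜ, |x i - (if i ∈ E then (1 : ℝ) else 0)| = ∑ i ∈ Eᶜ, |x i| :=
    Finset.sum_congr rfl fun i hi => by simp [Finset.mem_compl.1 hi]
  linarith
end

section
/- (p,q)-matchings imply the fundamental cone property (Lemma on matchings): Suppose every column of H has exactly d_v ones, let F be a set of variable nodes, and let p, q be nonnegative integers. Suppose there exists a set M of edges of the Tanner graph of H (a (p,q)-matching on F) such that: (a) no two edges of M are incident to the same check node; (b) every variable node i ∈ F is incident to at least p edges of M; and (c) for every variable node i' ∉ F, at least max{q − d_v + |N(i') ∩ N(F)|, 0} of the check nodes in N(i') ∩ N(F) are not endpoints of edges of M. Then every ω ∈ K(H) satisfies (2p − d_v)·‖ω_F‖₁ ≤ (d_v − q)·‖ω_{F^c}‖₁. -/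
open Finset

/-- The set of check-node neighbors of a set `S` of variable nodes. -/
def checkNbrs {m n : ℕ} (H : Fin m → Fin n → Bool) (S : Finset (Fin n)) :
    Finset (Fin m) :=
  S.biUnion fun i => Finset.univ.filter fun j => H j i = true

/-- At a check node, twice any neighboring coordinate of a fundamental cone vector is at most the
sum of all neighboring coordinates. -/
lemma two_mul_le_sum_of_mem_fundCone {m n : ℕ} {H : Fin m → Fin n → Bool} {ω : Fin n → ℝ}
    (hω : ω ∈ fundCone H) {j : Fin m} {i : Fin n} (hij : H j i = true) :
    2 * ω i ≤ ∑ i' ∈ Finset.univ.filter (fun i' => H j i' = true), ω i' := by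
  have h := hω.2 j i hij
  rw [← Finset.add_sum_erase _ ω (Finset.mem_filter.2 ⟨Finset.mem_univ i, hij⟩)]
  linarith

/-- Summing the cone inequalities over a set of edges and exchanging the order of summation. -/
lemma two_mul_sum_edges_le {m n : ℕ} {H : Fin m → Fin n → Bool} {ω : Fin n → ℝ}
    (hω : ω ∈ fundCone H) (A : Finset (Fin n × Fin m)) (hA : ∀ e ∈ A, H e.2 e.1 = true) :
    2 * ∑ e ∈ A, ω e.1 ≤ ∑ i, ((A.filter fun e => H e.2 i = true).card : ℝ) * ω i := by
  calc 2 * ∑ e ∈ A, ω e.1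
      ≤ ∑ e ∈ A, ∑ i ∈ Finset.univ.filter (fun i => H e.2 i = true), ω i := by
        rw [Finset.mul_sum]
        exact Finset.sum_le_sum fun e he => two_mul_le_sum_of_mem_fundCone hω (hA e he)
    _ = ∑ i, ((A.filter fun e => H e.2 i = true).card : ℝ) * ω i := by
        simp_rw [Finset.sum_filter]
        rw [Finset.sum_comm]
        refine Finset.sum_congr rfl fun i _ => ?_
        rw [← Finset.sum_filter, Finset.sum_const, nsmul_eq_mul]

/-- `(p,q)`-matchings imply the fundamental cone property. -/
theorem pq_matching_implies_FCP {m n : ℕ} (H : Fin m → Fin n → Bool)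
    (dv : ℕ) (hreg : ∀ i, (Finset.univ.filter fun j => H j i = true).card = dv)
    (F : Finset (Fin n)) (p q : ℕ)
    (M : Finset (Fin n × Fin m))
    (hedges : ∀ e ∈ M, H e.2 e.1 = true)
    (hdistinct : ∀ e ∈ M, ∀ e' ∈ M, e ≠ e' → e.2 ≠ e'.2)
    (hmatchF : ∀ i ∈ F, p ≤ (M.filter fun e => e.1 = i).card)
    (hmatchFc : ∀ i' ∉ F,
      (q : ℤ) - dv + (((Finset.univ.filter fun j => H j i' = true) ∩ checkNbrs H F).card : ℤ) ≤
        ((((Finset.univ.filter fun j => H j i' = true) ∩ checkNbrs H F).filter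
            fun j => ∀ e ∈ M, e.2 ≠ j).card : ℤ))
    (ω : Fin n → ℝ) (hω : ω ∈ fundCone H) :
    (2 * (p : ℝ) - dv) * ∑ i ∈ F, |ω i| ≤ ((dv : ℝ) - q) * ∑ i ∈ Fᶜ, |ω i| := by
  have hnn := hω.1
  simp_rw [abs_of_nonneg (hnn _)]
  set A := M.filter fun e => e.1 ∈ F with hA
  have hAM : ∀ e ∈ A, e ∈ M := fun e he => (Finset.mem_filter.1 he).1
  have hinj : Set.InjOn Prod.snd (A : Set (Fin n × Fin m)) := fun e he e' he' h => by
    by_contra hne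
    exact hdistinct e (hAM e he) e' (hAM e' he') hne h
  have hsum := two_mul_sum_edges_le hω A fun e he => hedges e (hAM e he)
  have hlower : (p : ℝ) * ∑ i ∈ F, ω i ≤ ∑ e ∈ A, ω e.1 := by
    rw [← Finset.sum_fiberwise_of_maps_to (s := A) (t := F) (g := Prod.fst)
      (fun e he => (Finset.mem_filter.1 he).2), Finset.mul_sum]
    refine Finset.sum_le_sum fun i hi => ?_
    have hfib : A.filter (fun e => e.1 = i) = M.filter fun e => e.1 = i := by
      ext e
      simp only [hA, Finset.mem_filter]
      grind
    rw [hfib, Finset.sum_congr rfl fun e he => by rw [(Finset.mem_filter.1 he).2],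
      Finset.sum_const, nsmul_eq_mul]
    exact mul_le_mul_of_nonneg_right (by exact_mod_cast hmatchF i hi) (hnn i)
  have hcardF : ∀ i, (A.filter fun e => H e.2 i = true).card ≤ dv := fun i => by
    rw [← hreg i]
    refine Finset.card_le_card_of_injOn Prod.snd (fun e he => ?_)
      (hinj.mono (Finset.coe_subset.2 (Finset.filter_subset _ _)))
    simpa using (Finset.mem_filter.1 he).2
  have hcardFc : ∀ i ∉ F, ((A.filter fun e => H e.2 i = true).card : ℤ) ≤ dv - q := by
    intro i hi
    have hc := hmatchFc i hi
    set B := (Finset.univ.filter fun j => H j i = true) ∩ checkNbrs H F with hB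
    have hle : (A.filter fun e => H e.2 i = true).card ≤
        (B.filter fun j => ¬ ∀ e ∈ M, e.2 ≠ j).card := by
      refine Finset.card_le_card_of_injOn Prod.snd (fun e he => ?_)
        (hinj.mono (Finset.coe_subset.2 (Finset.filter_subset _ _)))
      obtain ⟨heA, hei⟩ := Finset.mem_filter.1 he
      obtain ⟨heM, heF⟩ := Finset.mem_filter.1 heA
      refine Finset.mem_coe.2 (Finset.mem_filter.2 ⟨Finset.mem_inter.2 ⟨by simpa using hei, ?_⟩,
        fun h => h e heM rfl⟩)
      exact Finset.mem_biUnion.2 ⟨e.1, heF, by simpa using hedges e heM⟩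
    have hsplit := Finset.card_filter_add_card_filter_not (s := B) fun j => ∀ e ∈ M, e.2 ≠ j
    omega
  rw [← Finset.sum_add_sum_compl F] at hsum
  have hF : ∑ i ∈ F, ((A.filter fun e => H e.2 i = true).card : ℝ) * ω i ≤
      dv * ∑ i ∈ F, ω i := by
    rw [Finset.mul_sum]
    exact Finset.sum_le_sum fun i _ =>
      mul_le_mul_of_nonneg_right (by exact_mod_cast hcardF i) (hnn i)
  have hFc : ∑ i ∈ Fᶜ, ((A.filter fun e => H e.2 i = true).card : ℝ) * ω i ≤
      ((dv : ℝ) - q) * ∑ i ∈ Fᶜ, ω i := by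
    rw [Finset.mul_sum]
    exact Finset.sum_le_sum fun i hi =>
      mul_le_mul_of_nonneg_right (by exact_mod_cast hcardFc i (Finset.mem_compl.1 hi)) (hnn i)
  linarith
end

section
/- Identification of a high-error-rate subset from the LP output (Theorem on the importance set, all-zero codeword form): Let E ⊆ {1,…,n} with |E| = k', let E₁ ⊆ E, let C > 1, and suppose FCP(E₁, C) holds for H. Let the received word be x^r = 1_E, and let x^p ∈ K(H) satisfy ‖x^p − x^r‖₁ ≤ ‖x^r‖₁ (the LP decoder's output does at least as well as the all-zero codeword). Let L ⊆ {1,…,n} with |L| = k' be a set containing k' largest-magnitude entries of x^r − x^p, i.e., |x^r_i − x^p_i| ≥ |x^r_{i'} − x^p_{i'}| for all i ∈ L and i' ∉ L. Then |E ∩ L| ≥ k' − 2·((C+1)/(C−1))·(k' − |E₁|). -/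
open Finset

/-- The indicator vector of a set `E` of bit positions. -/
def indic {n : ℕ} (E : Finset (Fin n)) : Fin n → ℝ := fun i => if i ∈ E then 1 else 0

/-- If finite sets `A` and `B` have equal size and `f a + f b ≥ 1` for all `a ∈ A`, `b ∈ B`, then
the total mass of `f` on `A` and `B` is at least the common size. -/
lemma card_le_sum_add_sum_of_one_le_add {ι : Type*} {A B : Finset ι} {f : ι → ℝ}
    (hcard : A.card = B.card) (h : ∀ a ∈ A, ∀ b ∈ B, 1 ≤ f a + f b) :
    (A.card : ℝ) ≤ ∑ i ∈ A, f i + ∑ i ∈ B, f i := by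
  rcases A.eq_empty_or_nonempty with rfl | hA
  · simp [Finset.card_eq_zero.mp hcard.symm]
  have hpos : (0 : ℝ) < A.card := by exact_mod_cast hA.card_pos
  have hsum : ∑ a ∈ A, ∑ b ∈ B, (1 : ℝ) ≤ ∑ a ∈ A, ∑ b ∈ B, (f a + f b) :=
    Finset.sum_le_sum fun a ha => Finset.sum_le_sum fun b hb => h a ha b hb
  simp only [Finset.sum_add_distrib, Finset.sum_const, nsmul_eq_mul, ← Finset.mul_sum,
    ← hcard, mul_one] at hsum
  exact le_of_mul_le_mul_left (by linarith) hpos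

/-- The number of entries of `E` missed by the largest entries of `1_E - x` is at most the sum
of the entries of the nonnegative vector `x`. -/
lemma card_sdiff_le_sum {n : ℕ} {E L : Finset (Fin n)} {x : Fin n → ℝ} (hx : ∀ i, 0 ≤ x i)
    (hcard : L.card = E.card)
    (hL : ∀ i ∈ L, ∀ i' ∉ L, |indic E i' - x i'| ≤ |indic E i - x i|) :
    ((E \ L).card : ℝ) ≤ ∑ i, x i := by
  have hdisj : Disjoint (E \ L) (L \ E) := disjoint_sdiff_sdiff
  calc ((E \ L).card : ℝ) ≤ ∑ i ∈ E \ L, x i + ∑ i ∈ L \ E, x i := by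
        refine card_le_sum_add_sum_of_one_le_add (Finset.card_sdiff_comm hcard.symm) ?_
        intro a ha b hb
        rw [Finset.mem_sdiff] at ha hb
        have hab := hL b hb.1 a ha.2
        simp only [indic, ha.1, hb.2, if_true, if_false, zero_sub, abs_neg,
          abs_of_nonneg (hx b)] at hab
        linarith [le_abs_self (1 - x a)]
    _ = ∑ i ∈ (E \ L) ∪ (L \ E), x i := (Finset.sum_union hdisj).symm
    _ ≤ ∑ i, x i := Finset.sum_le_univ_sum_of_nonneg hx

/-- A nonnegative vector at least as close to `1_E` as the zero vector carries on `E₁ᶜ` at most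
`2 |E \ E₁|` more mass than on `E₁`. -/
lemma sum_compl_le_of_sum_abs_sub_le {n : ℕ} {E E₁ : Finset (Fin n)} (hE₁ : E₁ ⊆ E)
    {x : Fin n → ℝ} (hobj : ∑ i, |x i - indic E i| ≤ ∑ i, |indic E i|) :
    ∑ i ∈ E₁ᶜ, x i ≤ ∑ i ∈ E₁, x i + 2 * ((E.card : ℝ) - E₁.card) := by
  have hE : ∑ i, indic E i = E.card := by simp [indic]
  have habs : ∑ i, |indic E i| = E.card := by
    rw [← hE]
    refine Finset.sum_congr rfl fun i _ => abs_of_nonneg ?_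
    unfold indic
    split_ifs <;> norm_num
  have hon : ∑ i ∈ E₁, indic E i = E₁.card := by
    rw [Finset.card_eq_sum_ones, Nat.cast_sum]
    exact Finset.sum_congr rfl fun i hi => by simp [indic, hE₁ hi]
  have hindic := Finset.sum_add_sum_compl E₁ (indic E)
  have hdist := Finset.sum_add_sum_compl E₁ fun i => |x i - indic E i|
  have hlow : ∑ i ∈ E₁, (indic E i - x i) ≤ ∑ i ∈ E₁, |x i - indic E i| :=
    Finset.sum_le_sum fun i _ => by linarith [neg_abs_le (x i - indic E i)]
  have hhigh : ∑ i ∈ E₁ᶜ, (x i - indic E i) ≤ ∑ i ∈ E₁ᶜ, |x i - indic E i| :=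
    Finset.sum_le_sum fun i _ => le_abs_self _
  rw [Finset.sum_sub_distrib] at hlow hhigh
  linarith

/-- On the fundamental cone, `FCP(S, C)` gives the non-strict inequality without absolute values,
also at zero. -/
lemma FCP.mul_sum_le {m n : ℕ} {H : Fin m → Fin n → Bool} {S : Finset (Fin n)} {C : ℝ}
    (h : FCP H S C) {x : Fin n → ℝ} (hx : x ∈ fundCone H) :
    C * ∑ i ∈ S, x i ≤ ∑ i ∈ Sᶜ, x i := by
  rcases eq_or_ne x 0 with rfl | hne
  · simp
  · simpa only [abs_of_nonneg (hx.1 _)] using (h x hx hne).le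

/-- Identification of a high-error-rate subset from the LP output
(theorem on the importance set, all-zero codeword form). -/
theorem importance_set {m n : ℕ} (H : Fin m → Fin n → Bool)
    (E E₁ : Finset (Fin n)) (hE₁ : E₁ ⊆ E)
    (C : ℝ) (hC : 1 < C) (hFCP : FCP H E₁ C)
    (xp : Fin n → ℝ) (hxp : xp ∈ fundCone H)
    (hobj : ∑ i, |xp i - indic E i| ≤ ∑ i, |indic E i|)
    (L : Finset (Fin n)) (hLcard : L.card = E.card)
    (hL : ∀ i ∈ L, ∀ i' ∉ L, |indic E i' - xp i'| ≤ |indic E i - xp i|) :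
    (E.card : ℝ) - 2 * ((C + 1) / (C - 1)) * ((E.card : ℝ) - E₁.card) ≤
      ((E ∩ L).card : ℝ) := by
  have hC' : 0 < C - 1 := sub_pos.mpr hC
  have hmiss := card_sdiff_le_sum hxp.1 hLcard hL
  have hcompl := sum_compl_le_of_sum_abs_sub_le hE₁ hobj
  have hcone := hFCP.mul_sum_le hxp
  have hsplit := Finset.sum_add_sum_compl E₁ xp
  have hcard : ((E ∩ L).card : ℝ) + (E \ L).card = E.card := by
    exact_mod_cast Finset.card_inter_add_card_sdiff E L
  have hbound : ∑ i, xp i ≤ 2 * ((C + 1) / (C - 1)) * ((E.card : ℝ) - E₁.card) := by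
    have heq : 2 * ((C + 1) / (C - 1)) * ((E.card : ℝ) - E₁.card) =
        2 * (C + 1) * ((E.card : ℝ) - E₁.card) / (C - 1) := by ring
    rw [heq, le_div_iff₀ hC', ← hsplit]
    nlinarith [mul_le_mul_of_nonneg_left hcompl hC'.le]
  linarith
end

section
/- Integral pseudocodewords are exactly the codewords: a binary vector x ∈ {0,1}^n lies in the fundamental polytope P(H) if and only if Σ_{i∈I_j} x_i is even for every row j of H (i.e., if and only if x is a codeword of the code with parity-check matrix H). -/
open Finset

/-- An extreme point of a convex set `K` that lies in the convex hull of a subset of `K`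
belongs to that subset. -/
theorem mem_of_mem_extremePoints_of_mem_convexHull {E : Type*} [AddCommGroup E] [Module ℝ E]
    {K A : Set E} {x : E} (hK : Convex ℝ K) (hA : A ⊆ K) (hx : x ∈ K.extremePoints ℝ)
    (hxA : x ∈ convexHull ℝ A) : x ∈ A :=
  extremePoints_convexHull_subset <|
    inter_extremePoints_subset_extremePoints_of_subset (convexHull_min hA hK) ⟨hxA, hx⟩

/-- Binary vectors are extreme points of the unit cube. -/
theorem binary_mem_extremePoints_cube {ι : Type*} (b : ι → Bool) :
    (fun i => if b i then (1 : ℝ) else 0) ∈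
      (Set.univ.pi fun _ : ι => Set.Icc (0 : ℝ) 1).extremePoints ℝ := by
  rw [extremePoints_pi]
  intro i _
  rw [Set.extremePoints_Icc zero_le_one]
  cases b i <;> simp

/-- Integral pseudocodewords are exactly the codewords: a binary vector lies in
the fundamental polytope iff it satisfies every parity check of `H`. -/
theorem integral_pseudocodewords_are_codewords {m n : ℕ}
    (H : Fin m → Fin n → Bool) (b : Fin n → Bool) :
    (fun i => if b i then (1 : ℝ) else 0) ∈ fundPolytope H ↔
      ∀ j : Fin m,
        Even ((Finset.univ.filter fun i => H j i = true ∧ b i = true).card) := by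
  rw [fundPolytope, Set.mem_iInter]
  refine forall_congr' fun j => ⟨fun h => ?_, fun h => subset_convexHull ℝ _ ⟨b, rfl, h⟩⟩
  have hsub : localCodewords H j ⊆ Set.univ.pi fun _ : Fin n => Set.Icc (0 : ℝ) 1 := by
    rintro _ ⟨c, rfl, -⟩
    exact (binary_mem_extremePoints_cube c).1
  obtain ⟨c, hc, he⟩ := mem_of_mem_extremePoints_of_mem_convexHull
    (convex_pi fun _ _ => convex_Icc 0 1) hsub (binary_mem_extremePoints_cube b) h
  have hbc : b = c := by
    funext i
    have hi := congrFun hc i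
    cases hb : b i <;> cases hc' : c i <;> simp_all
  rwa [hbc]
end

section
/- Support identification from an ℓ1-approximation (deviation lemma): Let x ∈ ℝ^n be a k-sparse vector (exactly k nonzero entries) with support set K, and let x̂ ∈ ℝ^n be any vector. Let L ⊆ {1,…,n} be a k-support set of x̂, i.e., |L| = k and |x̂_i| ≥ |x̂_{i'}| for all i ∈ L and i' ∉ L. If d = ‖x − x̂‖₁, then |K ∩ L| ≥ k − W(x, d), where W(x, λ) = max{|A| : A ⊆ supp(x), ‖x_A‖₁ ≤ λ}. -/
open Finset

/-- `W x lam`: the size of the largest subset `A` of the support of `x`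
with `‖x_A‖₁ ≤ lam`. -/
noncomputable def Wfun {n : ℕ} (x : Fin n → ℝ) (lam : ℝ) : ℕ :=
  ((Finset.univ.filter fun i => x i ≠ 0).powerset.filter
    fun A => ∑ i ∈ A, |x i| ≤ lam).sup Finset.card

/-- If every value of `f` on `A` is bounded by every value of `g` on `B` and the two finsets have
the same size, then the sum of `f` over `A` is at most the sum of `g` over `B`. -/
theorem sum_le_sum_of_card_eq_of_forall_le {ι κ : Type*} {A : Finset ι} {B : Finset κ}
    {f : ι → ℝ} {g : κ → ℝ} (hcard : A.card = B.card) (h : ∀ a ∈ A, ∀ b ∈ B, f a ≤ g b) :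
    ∑ a ∈ A, f a ≤ ∑ b ∈ B, g b := by
  let e := Finset.equivOfCardEq hcard
  rw [← Finset.sum_coe_sort A, ← Finset.sum_coe_sort B, ← e.sum_comp]
  exact Finset.sum_le_sum fun a _ => h a a.2 (e a) (e a).2

/-- A subset of the support with `ℓ1` mass at most `lam` has at most `Wfun x lam` elements. -/
theorem card_le_Wfun {n : ℕ} {x : Fin n → ℝ} {lam : ℝ} {A : Finset (Fin n)}
    (hA : A ⊆ Finset.univ.filter fun i => x i ≠ 0) (hsum : ∑ i ∈ A, |x i| ≤ lam) :
    A.card ≤ Wfun x lam :=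
  Finset.le_sup (f := Finset.card)
    (Finset.mem_filter.mpr ⟨Finset.mem_powerset.mpr hA, hsum⟩)

/-- Support identification from an ℓ1-approximation (deviation lemma). -/
theorem support_identification {n : ℕ} (x xhat : Fin n → ℝ) (k : ℕ)
    (hk : (Finset.univ.filter fun i => x i ≠ 0).card = k)
    (L : Finset (Fin n)) (hLcard : L.card = k)
    (hL : ∀ i ∈ L, ∀ i' ∉ L, |xhat i'| ≤ |xhat i|)
    (d : ℝ) (hd : d = ∑ i, |x i - xhat i|) :
    (k : ℤ) - Wfun x d ≤
      (((Finset.univ.filter fun i => x i ≠ 0) ∩ L).card : ℤ) := by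
  set K := Finset.univ.filter fun i => x i ≠ 0 with hK
  have hcard : (K \ L).card = (L \ K).card := Finset.card_sdiff_comm (hk.trans hLcard.symm)
  have hexchange : ∑ i ∈ K \ L, |xhat i| ≤ ∑ i ∈ L \ K, |x i - xhat i| := by
    refine sum_le_sum_of_card_eq_of_forall_le hcard fun a ha b hb => ?_
    rw [Finset.mem_sdiff] at ha hb
    have hxb : x b = 0 := by simpa [hK] using hb.2
    simpa [hxb] using hL b hb.1 a ha.2
  have hdisj : Disjoint (K \ L) (L \ K) := disjoint_sdiff_sdiff
  have hsum : ∑ i ∈ K \ L, |x i| ≤ d := calc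
    ∑ i ∈ K \ L, |x i| ≤ ∑ i ∈ K \ L, (|x i - xhat i| + |xhat i|) :=
      Finset.sum_le_sum fun i _ => by simpa using abs_add_le (x i - xhat i) (xhat i)
    _ = ∑ i ∈ K \ L, |x i - xhat i| + ∑ i ∈ K \ L, |xhat i| := Finset.sum_add_distrib
    _ ≤ ∑ i ∈ K \ L, |x i - xhat i| + ∑ i ∈ L \ K, |x i - xhat i| := by gcongr
    _ = ∑ i ∈ (K \ L) ∪ (L \ K), |x i - xhat i| := (Finset.sum_union hdisj).symm
    _ ≤ ∑ i, |x i - xhat i| :=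
      Finset.sum_le_sum_of_subset_of_nonneg (Finset.subset_univ _) fun _ _ _ => abs_nonneg _
    _ = d := hd.symm
  have hW : (K \ L).card ≤ Wfun x d := card_le_Wfun Finset.sdiff_subset hsum
  have hsplit := Finset.card_sdiff_add_card_inter K L
  omega
end
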